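/- For the constraint functions of the relativistic particle with curvature on the open set where (x₁ x₁) ≠ 0, the following Poisson-bracket identities hold: {φ¹,ψ¹} = 2ψ¹; {φ¹,H} = φ² and {ψ¹,H} = ψ² (so φ², ψ² are the secondary constraints); {φ¹,φ²} = −φ², {φ¹,ψ²} = ψ², {ψ¹,φ²} = −ψ², {ψ¹,ψ²} = (α²/(x₁ x₁)²) φ²; {ψ²,H} = ψ³ and {φ²,H} = 0 (so ψ³ is the tertiary constraint and the stabilization algorithm stops); {φ²,ψ²} = ψ³; and {ψ³,H} = {ψ³,φ¹} = {ψ³,ψ¹} = {ψ³,φ²} = {ψ³,ψ²} = 0. In particular, every Poisson bracket of two of the constraints φ¹, ψ¹, φ², ψ², ψ³ is a smooth-function combination of these constraints, i.e. all constraints of the model are first class. -/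

import Mathlib

open scoped BigOperators Matrix

noncomputable section

/-- `V d` is `ℝ^d`. -/
abbrev V (d : ℕ) := Fin d → ℝ

variable {d : ℕ}

/-- The bilinear form determined by the symmetric matrix `B`: `(u v) = uᵀ B v`. -/
def bf (B : Matrix (Fin d) (Fin d) ℝ) (u v : V d) : ℝ := u ⬝ᵥ B *ᵥ v

/-- The bilinear form induced by `B` on covectors: `B⁻¹(c,c') = cᵀ B⁻¹ c'`. -/
def ibf (B : Matrix (Fin d) (Fin d) ℝ) (c c' : V d) : ℝ := c ⬝ᵥ B⁻¹ *ᵥ c'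

/-- The phase space of the second-order relativistic particle model:
points `(x₀, x₁, p⁰, p¹)`. -/
abbrev Ph (d : ℕ) := V d × V d × V d × V d

/-- Partial differential of `f` in the slot `x₀`, as a covector. -/
def dx0 (f : Ph d → ℝ) (z : Ph d) : V d :=
  fun a => fderiv ℝ f z (Pi.single a 1, 0, 0, 0)

/-- Partial differential of `f` in the slot `x₁`, as a covector. -/
def dx1 (f : Ph d → ℝ) (z : Ph d) : V d :=
  fun a => fderiv ℝ f z (0, Pi.single a 1, 0, 0)

/-- Partial differential of `f` in the slot `p⁰`, as a covector. -/
def dp0 (f : Ph d → ℝ) (z : Ph d) : V d :=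
  fun a => fderiv ℝ f z (0, 0, Pi.single a 1, 0)

/-- Partial differential of `f` in the slot `p¹`, as a covector. -/
def dp1 (f : Ph d → ℝ) (z : Ph d) : V d :=
  fun a => fderiv ℝ f z (0, 0, 0, Pi.single a 1)

/-- The canonical Poisson bracket on the phase space, momenta being
identified with vectors via `B`:
`{f,g} = Σ_{r=0,1} (B⁻¹(d_{x_r}f, d_{p^r}g) − B⁻¹(d_{p^r}f, d_{x_r}g))`. -/
def PB (B : Matrix (Fin d) (Fin d) ℝ) (f g : Ph d → ℝ) (z : Ph d) : ℝ :=
  ibf B (dx0 f z) (dp0 g z) + ibf B (dx1 f z) (dp1 g z) -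
  ibf B (dp0 f z) (dx0 g z) - ibf B (dp1 f z) (dx1 g z)

/-- The canonical Hamiltonian `H = (p⁰ x₁)`. -/
def Ham (B : Matrix (Fin d) (Fin d) ℝ) (z : Ph d) : ℝ := bf B z.2.2.1 z.2.1

/-- The primary constraint `φ¹ = (p¹ x₁)`. -/
def phi1 (B : Matrix (Fin d) (Fin d) ℝ) (z : Ph d) : ℝ := bf B z.2.2.2 z.2.1

/-- The primary constraint `ψ¹ = ((p¹ p¹) − α²/(x₁ x₁))/2`. -/
def psi1 (B : Matrix (Fin d) (Fin d) ℝ) (α : ℝ) (z : Ph d) : ℝ :=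
  (bf B z.2.2.2 z.2.2.2 - α^2 / bf B z.2.1 z.2.1) / 2

/-- The secondary constraint `φ² = −(p⁰ x₁)`. -/
def phi2 (B : Matrix (Fin d) (Fin d) ℝ) (z : Ph d) : ℝ := -bf B z.2.2.1 z.2.1

/-- The secondary constraint `ψ² = −(p⁰ p¹)`. -/
def psi2 (B : Matrix (Fin d) (Fin d) ℝ) (z : Ph d) : ℝ := -bf B z.2.2.1 z.2.2.2

/-- The tertiary constraint `ψ³ = (p⁰ p⁰)`. -/
def psi3 (B : Matrix (Fin d) (Fin d) ℝ) (z : Ph d) : ℝ := bf B z.2.2.1 z.2.2.1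

/-- On covectors of the form `B u`, `B v` the induced form is `(u v)`. -/
lemma ibf_mulVec {B : Matrix (Fin d) (Fin d) ℝ} (hB : B.IsSymm) (hdet : IsUnit B.det)
    (u v : V d) : ibf B (B *ᵥ u) (B *ᵥ v) = bf B u v := by
  rw [ibf, bf, Matrix.mulVec_mulVec, Matrix.nonsing_inv_mul _ hdet, Matrix.one_mulVec,
    Matrix.dotProduct_mulVec, ← Matrix.mulVec_transpose, hB.eq]

lemma bf_comm {B : Matrix (Fin d) (Fin d) ℝ} (hB : B.IsSymm) (u v : V d) :
    bf B u v = bf B v u := by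
  rw [bf, bf, Matrix.dotProduct_mulVec, ← Matrix.mulVec_transpose, hB.eq, dotProduct_comm]

lemma ibf_comm {B : Matrix (Fin d) (Fin d) ℝ} (hB : B.IsSymm) (c c' : V d) :
    ibf B c c' = ibf B c' c :=
  bf_comm (B := B⁻¹) (by rw [Matrix.IsSymm, Matrix.transpose_nonsing_inv, hB.eq]) c c'

lemma PB_swap {B : Matrix (Fin d) (Fin d) ℝ} (hB : B.IsSymm) (f g : Ph d → ℝ) (z : Ph d) :
    PB B f g z = -PB B g f z := by
  simp only [PB]
  rw [ibf_comm hB (dx0 f z), ibf_comm hB (dx1 f z), ibf_comm hB (dp0 f z), ibf_comm hB (dp1 f z)]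
  ring

lemma PB_self {B : Matrix (Fin d) (Fin d) ℝ} (hB : B.IsSymm) (f : Ph d → ℝ) (z : Ph d) :
    PB B f f z = 0 := by
  linarith [PB_swap hB f f z]

lemma bf_single {B : Matrix (Fin d) (Fin d) ℝ} (hB : B.IsSymm) (u : V d) (a : Fin d) :
    bf B u (Pi.single a 1) = (B *ᵥ u) a := by
  rw [bf_comm hB, bf, single_one_dotProduct]

@[simp] lemma bf_zero_left (B : Matrix (Fin d) (Fin d) ℝ) (v : V d) : bf B 0 v = 0 := by
  simp [bf]

@[simp] lemma bf_zero_right (B : Matrix (Fin d) (Fin d) ℝ) (u : V d) : bf B u 0 = 0 := by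
  simp [bf]

@[simp] lemma bf_smul_left (B : Matrix (Fin d) (Fin d) ℝ) (r : ℝ) (u v : V d) :
    bf B (r • u) v = r * bf B u v := by
  simp [bf]

@[simp] lemma bf_smul_right (B : Matrix (Fin d) (Fin d) ℝ) (r : ℝ) (u v : V d) :
    bf B u (r • v) = r * bf B u v := by
  simp [bf, Matrix.mulVec_smul]

@[simp] lemma bf_neg_left (B : Matrix (Fin d) (Fin d) ℝ) (u v : V d) :
    bf B (-u) v = -bf B u v := by
  simp [bf]

@[simp] lemma bf_neg_right (B : Matrix (Fin d) (Fin d) ℝ) (u v : V d) :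
    bf B u (-v) = -bf B u v := by
  simp [bf, Matrix.mulVec_neg]

/-- `f` is differentiable at `z` and `w` is its gradient there with respect to `B`, slot by slot. -/
def HasBGradAt (B : Matrix (Fin d) (Fin d) ℝ) (f : Ph d → ℝ) (w z : Ph d) : Prop :=
  ∃ L : Ph d →L[ℝ] ℝ, HasFDerivAt f L z ∧
    ∀ h : Ph d, L h = bf B w.1 h.1 + bf B w.2.1 h.2.1 + bf B w.2.2.1 h.2.2.1 +
      bf B w.2.2.2 h.2.2.2

/-- The Poisson bracket in terms of gradients. -/
lemma PB_eq_of_hasBGradAt {B : Matrix (Fin d) (Fin d) ℝ} (hB : B.IsSymm) (hdet : IsUnit B.det)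
    {f g : Ph d → ℝ} {w w' z : Ph d} (hf : HasBGradAt B f w z) (hg : HasBGradAt B g w' z) :
    PB B f g z = bf B w.1 w'.2.2.1 + bf B w.2.1 w'.2.2.2 - bf B w.2.2.1 w'.1 -
      bf B w.2.2.2 w'.2.1 := by
  have partials : ∀ {f : Ph d → ℝ} {w : Ph d}, HasBGradAt B f w z →
      dx0 f z = B *ᵥ w.1 ∧ dx1 f z = B *ᵥ w.2.1 ∧ dp0 f z = B *ᵥ w.2.2.1 ∧
        dp1 f z = B *ᵥ w.2.2.2 := by
    rintro f w ⟨L, hL, hw⟩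
    refine ⟨?_, ?_, ?_, ?_⟩ <;> funext a <;>
      simp [dx0, dx1, dp0, dp1, hL.fderiv, hw, bf_single hB]
  obtain ⟨h0, h1, h2, h3⟩ := partials hf
  obtain ⟨k0, k1, k2, k3⟩ := partials hg
  simp only [PB, h0, h1, h2, h3, k0, k1, k2, k3, ibf_mulVec hB hdet]

lemma HasBGradAt.neg {B : Matrix (Fin d) (Fin d) ℝ} {f : Ph d → ℝ} {w z : Ph d}
    (hf : HasBGradAt B f w z) : HasBGradAt B (fun y => -f y) (-w) z := by
  obtain ⟨L, hL, hw⟩ := hf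
  refine ⟨-L, hL.neg, fun h => ?_⟩
  simp [hw]
  ring

/-- The form `B` as a continuous bilinear map. -/
def bfL (B : Matrix (Fin d) (Fin d) ℝ) : V d →L[ℝ] V d →L[ℝ] ℝ :=
  (Matrix.toLinearMap₂' ℝ B).toContinuousBilinearMap

lemma bfL_apply (B : Matrix (Fin d) (Fin d) ℝ) (u v : V d) : bfL B u v = bf B u v := by
  rw [bfL, LinearMap.toContinuousBilinearMap_apply, Matrix.toLinearMap₂'_apply', bf]

lemma hasFDerivAt_bf (B : Matrix (Fin d) (Fin d) ℝ) (P Q : Ph d →L[ℝ] V d) (z : Ph d) :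
    ∃ L : Ph d →L[ℝ] ℝ, HasFDerivAt (fun y => bf B (P y) (Q y)) L z ∧
      ∀ h, L h = bf B (P z) (Q h) + bf B (P h) (Q z) := by
  have hL := (bfL B).hasFDerivAt_of_bilinear (P.hasFDerivAt (x := z)) (Q.hasFDerivAt (x := z))
  simp only [bfL_apply] at hL
  exact ⟨_, hL, fun h => by simp [bfL_apply]⟩

/-- The projection of phase space to the slot `x₁`. -/
def prX1 : Ph d →L[ℝ] V d := .comp (.fst ℝ _ _) (.snd ℝ _ _)

/-- The projection of phase space to the slot `p⁰`. -/
def prP0 : Ph d →L[ℝ] V d := .comp (.fst ℝ _ _) (.comp (.snd ℝ _ _) (.snd ℝ _ _))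

/-- The projection of phase space to the slot `p¹`. -/
def prP1 : Ph d →L[ℝ] V d := .comp (.snd ℝ _ _) (.comp (.snd ℝ _ _) (.snd ℝ _ _))

lemma hasBGradAt_Ham {B : Matrix (Fin d) (Fin d) ℝ} (hB : B.IsSymm) (z : Ph d) :
    HasBGradAt B (Ham B) (0, z.2.2.1, z.2.1, 0) z := by
  obtain ⟨L, hL, h⟩ := hasFDerivAt_bf B prP0 prX1 z
  refine ⟨L, hL, fun k => ?_⟩
  simp [h, prP0, prX1, bf_comm hB k.2.2.1]

lemma hasBGradAt_phi1 {B : Matrix (Fin d) (Fin d) ℝ} (hB : B.IsSymm) (z : Ph d) :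
    HasBGradAt B (phi1 B) (0, z.2.2.2, 0, z.2.1) z := by
  obtain ⟨L, hL, h⟩ := hasFDerivAt_bf B prP1 prX1 z
  refine ⟨L, hL, fun k => ?_⟩
  simp [h, prP1, prX1, bf_comm hB k.2.2.2]

lemma hasBGradAt_phi2 {B : Matrix (Fin d) (Fin d) ℝ} (hB : B.IsSymm) (z : Ph d) :
    HasBGradAt B (phi2 B) (-(0, z.2.2.1, z.2.1, 0)) z :=
  (hasBGradAt_Ham hB z).neg

lemma hasBGradAt_psi2 {B : Matrix (Fin d) (Fin d) ℝ} (hB : B.IsSymm) (z : Ph d) :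
    HasBGradAt B (psi2 B) (-(0, 0, z.2.2.2, z.2.2.1)) z := by
  obtain ⟨L, hL, h⟩ := hasFDerivAt_bf B prP0 prP1 z
  refine HasBGradAt.neg ⟨L, hL, fun k => ?_⟩
  simp [h, prP0, prP1, bf_comm hB k.2.2.1, add_comm]

lemma hasBGradAt_psi3 {B : Matrix (Fin d) (Fin d) ℝ} (hB : B.IsSymm) (z : Ph d) :
    HasBGradAt B (psi3 B) (0, 0, (2 : ℝ) • z.2.2.1, 0) z := by
  obtain ⟨L, hL, h⟩ := hasFDerivAt_bf B prP0 prP0 z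
  refine ⟨L, hL, fun k => ?_⟩
  simp [h, prP0, bf_comm hB k.2.2.1, two_mul]

lemma hasBGradAt_psi1 {B : Matrix (Fin d) (Fin d) ℝ} (hB : B.IsSymm) (α : ℝ) {z : Ph d}
    (hz : bf B z.2.1 z.2.1 ≠ 0) :
    HasBGradAt B (psi1 B α) (0, (α ^ 2 / bf B z.2.1 z.2.1 ^ 2) • z.2.1, 0, z.2.2.2) z := by
  obtain ⟨L, hL, h⟩ := hasFDerivAt_bf B prP1 prP1 z
  obtain ⟨M, hM, k⟩ := hasFDerivAt_bf B prX1 prX1 z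
  have hinv := (hasDerivAt_inv hz).comp_hasFDerivAt z hM
  refine ⟨_, ((hL.sub (hinv.const_mul (α ^ 2))).mul_const (2⁻¹ : ℝ)).congr_of_eventuallyEq
    (.of_forall fun y => ?_), fun v => ?_⟩
  · simp [psi1, prP1, prX1, div_eq_mul_inv]
  · simp [h, k, prP1, prX1, bf_comm hB v.2.1, bf_comm hB v.2.2.2]
    field_simp
    ring

lemma contDiff_bf_x1 (B : Matrix (Fin d) (Fin d) ℝ) {n : WithTop ℕ∞} :
    ContDiff ℝ n (fun z : Ph d => bf B z.2.1 z.2.1) := by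
  have : ContDiff ℝ n (fun z : Ph d => bfL B z.2.1 z.2.1) := by fun_prop
  simpa only [bfL_apply] using this

/-- A function which is a smooth multiple of one member of a finite family is a smooth combination
of the family. -/
lemma exists_smooth_combination {E ι : Type*} [NormedAddCommGroup E] [NormedSpace ℝ E]
    [Fintype ι] [DecidableEq ι] {n : WithTop ℕ∞} {C : ι → E → ℝ} {s : Set E} {f a : E → ℝ} (m : ι)
    (ha : ContDiffOn ℝ n a s) (hf : ∀ z ∈ s, f z = a z * C m z) :
    ∃ c : ι → E → ℝ, (∀ k, ContDiffOn ℝ n (c k) s) ∧ ∀ z ∈ s, f z = ∑ k, c k z * C k z := by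
  refine ⟨Pi.single m a, fun k => ?_, fun z hz => ?_⟩
  · obtain rfl | hk := eq_or_ne k m
    · simpa using ha
    · rw [Pi.single_eq_of_ne hk]
      exact contDiffOn_const
  · rw [hf z hz, Finset.sum_eq_single m]
    · simp
    · intro k _ hk
      simp [Pi.single_eq_of_ne hk]
    · simp

/-- the constraint algebra of the particle with curvature.
On the open set where `(x₁ x₁) ≠ 0`, the Poisson brackets of the constraints
`φ¹, ψ¹, φ², ψ², ψ³` and the Hamiltonian `H` are as computed in the paper;
in particular every Poisson bracket of two of the constraints is a
smooth-function combination of the constraints, i.e. all the constraints of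
the model are first class. -/
theorem curvature_constraint_algebra_first_class
    (d : ℕ) (hd : 3 ≤ d) (B : Matrix (Fin d) (Fin d) ℝ)
    (hBsymm : B.IsSymm) (hBnd : IsUnit B.det)
    (α : ℝ) (hα : α ≠ 0) :
    (∀ z : Ph d, bf B z.2.1 z.2.1 ≠ 0 →
      PB B (phi1 B) (psi1 B α) z = 2 * psi1 B α z ∧
      PB B (phi1 B) (Ham B) z = phi2 B z ∧
      PB B (psi1 B α) (Ham B) z = psi2 B z ∧
      PB B (phi1 B) (phi2 B) z = -phi2 B z ∧
      PB B (phi1 B) (psi2 B) z = psi2 B z ∧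
      PB B (psi1 B α) (phi2 B) z = -psi2 B z ∧
      PB B (psi1 B α) (psi2 B) z = α^2 / (bf B z.2.1 z.2.1)^2 * phi2 B z ∧
      PB B (psi2 B) (Ham B) z = psi3 B z ∧
      PB B (phi2 B) (Ham B) z = 0 ∧
      PB B (phi2 B) (psi2 B) z = psi3 B z ∧
      PB B (psi3 B) (Ham B) z = 0 ∧
      PB B (psi3 B) (phi1 B) z = 0 ∧
      PB B (psi3 B) (psi1 B α) z = 0 ∧
      PB B (psi3 B) (phi2 B) z = 0 ∧
      PB B (psi3 B) (psi2 B) z = 0) ∧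
    (∀ i j : Fin 5,
      ∃ c : Fin 5 → Ph d → ℝ,
        (∀ m : Fin 5,
          ContDiffOn ℝ (⊤ : ℕ∞) (c m) {z : Ph d | bf B z.2.1 z.2.1 ≠ 0}) ∧
        ∀ z : Ph d, bf B z.2.1 z.2.1 ≠ 0 →
          PB B (![phi1 B, psi1 B α, phi2 B, psi2 B, psi3 B] i)
               (![phi1 B, psi1 B α, phi2 B, psi2 B, psi3 B] j) z =
            ∑ m : Fin 5,
              c m z * ![phi1 B, psi1 B α, phi2 B, psi2 B, psi3 B] m z) := by
  refine (and_iff_left_of_imp fun brackets => ?_).2 ?_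
  · set C := ![phi1 B, psi1 B α, phi2 B, psi2 B, psi3 B] with hC
    set U : Set (Ph d) := {z | bf B z.2.1 z.2.1 ≠ 0}
    have of_swap : ∀ {i j}, (∃ m a, ContDiffOn ℝ (⊤ : ℕ∞) a U ∧
        ∀ z ∈ U, PB B (C i) (C j) z = a z * C m z) →
        ∃ m a, ContDiffOn ℝ (⊤ : ℕ∞) a U ∧ ∀ z ∈ U, PB B (C j) (C i) z = a z * C m z := by
      rintro i j ⟨m, a, ha, h⟩
      exact ⟨m, fun z => -a z, ha.neg, fun z hz => by rw [PB_swap hBsymm, h z hz, neg_mul]⟩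
    have of_const (f : Ph d → ℝ) (m : Fin 5) (r : ℝ) (h : ∀ z ∈ U, f z = r * C m z) :
        ∃ m a, ContDiffOn ℝ (⊤ : ℕ∞) a U ∧ ∀ z ∈ U, f z = a z * C m z :=
      ⟨m, fun _ => r, contDiffOn_const, h⟩
    have of_lt : ∀ i j : Fin 5, i < j → ∃ m a, ContDiffOn ℝ (⊤ : ℕ∞) a U ∧
        ∀ z ∈ U, PB B (C i) (C j) z = a z * C m z := by
      have h01 := of_const (PB B (C 0) (C 1)) 1 2 fun z hz => by
        simpa [hC] using (brackets z hz).1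
      have h02 := of_const (PB B (C 0) (C 2)) 2 (-1) fun z hz => by
        simpa [hC] using (brackets z hz).2.2.2.1
      have h03 := of_const (PB B (C 0) (C 3)) 3 1 fun z hz => by
        simpa [hC] using (brackets z hz).2.2.2.2.1
      have h12 := of_const (PB B (C 1) (C 2)) 3 (-1) fun z hz => by
        simpa [hC] using (brackets z hz).2.2.2.2.2.1
      have h13 : ∃ m a, ContDiffOn ℝ (⊤ : ℕ∞) a U ∧
          ∀ z ∈ U, PB B (C 1) (C 3) z = a z * C m z :=
        ⟨2, fun z => α ^ 2 / bf B z.2.1 z.2.1 ^ 2,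
          contDiffOn_const.div ((contDiff_bf_x1 B).pow 2).contDiffOn fun z hz => pow_ne_zero 2 hz,
          fun z hz => by simpa [hC] using (brackets z hz).2.2.2.2.2.2.1⟩
      have h23 := of_const (PB B (C 2) (C 3)) 4 1 fun z hz => by
        simpa [hC] using (brackets z hz).2.2.2.2.2.2.2.2.2.1
      have h40 := of_const (PB B (C 4) (C 0)) 0 0 fun z hz => by
        simpa [hC] using (brackets z hz).2.2.2.2.2.2.2.2.2.2.2.1
      have h41 := of_const (PB B (C 4) (C 1)) 0 0 fun z hz => by
        simpa [hC] using (brackets z hz).2.2.2.2.2.2.2.2.2.2.2.2.1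
      have h42 := of_const (PB B (C 4) (C 2)) 0 0 fun z hz => by
        simpa [hC] using (brackets z hz).2.2.2.2.2.2.2.2.2.2.2.2.2.1
      have h43 := of_const (PB B (C 4) (C 3)) 0 0 fun z hz => by
        simpa [hC] using (brackets z hz).2.2.2.2.2.2.2.2.2.2.2.2.2.2
      intro i j hij
      fin_cases i <;> fin_cases j <;> first
        | exact absurd hij (by decide)
        | assumption
        | exact of_swap (by assumption)
    intro i j
    obtain ⟨m, a, ha, h⟩ : ∃ m a, ContDiffOn ℝ (⊤ : ℕ∞) a U ∧
        ∀ z ∈ U, PB B (C i) (C j) z = a z * C m z := by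
      rcases lt_trichotomy i j with hij | rfl | hij
      · exact of_lt i j hij
      · exact of_const _ 0 0 fun z _ => by rw [PB_self hBsymm, zero_mul]
      · exact of_swap (of_lt j i hij)
    exact exists_smooth_combination m ha h
  · intro z hz
    have hH := hasBGradAt_Ham hBsymm z
    have hφ₁ := hasBGradAt_phi1 hBsymm z
    have hψ₁ := hasBGradAt_psi1 hBsymm α hz
    have hφ₂ := hasBGradAt_phi2 hBsymm z
    have hψ₂ := hasBGradAt_psi2 hBsymm z
    have hψ₃ := hasBGradAt_psi3 hBsymm z
    have pb {f g : Ph d → ℝ} {w w' : Ph d} (hf : HasBGradAt B f w z)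
        (hg : HasBGradAt B g w' z) := PB_eq_of_hasBGradAt hBsymm hBnd hf hg
    rw [pb hφ₁ hψ₁, pb hφ₁ hH, pb hψ₁ hH, pb hφ₁ hφ₂, pb hφ₁ hψ₂, pb hψ₁ hφ₂, pb hψ₁ hψ₂,
      pb hψ₂ hH, pb hφ₂ hH, pb hφ₂ hψ₂, pb hψ₃ hH, pb hψ₃ hφ₁, pb hψ₃ hψ₁, pb hψ₃ hφ₂,
      pb hψ₃ hψ₂]
    simp [phi2, psi1, psi2, psi3, bf_comm hBsymm z.2.1 z.2.2.1,
      bf_comm hBsymm z.2.2.2 z.2.2.1]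
    field_simp

end
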